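/- For i = 1, …, m let f_i : ℙⁿ → ℙⁿ be a morphism of degree d_i > 1 defined over a number field K, and let φ = f_1 × ⋯ × f_m : (ℙⁿ)^m → (ℙⁿ)^m be the product morphism. Then φ is a dominant endomorphism with global height expansion coefficient μ(φ) = min_i d_i > 1, and consequently the set of preperiodic points Preper(φ) ⊆ (ℙⁿ)^m(K̄) is a set of bounded height with respect to any Weil height associated to an ample divisor. -/

import Mathlib

open MvPolynomial

/-- The set of points of the multiprojective space `𝕏 = ∏_{i : ι} ℙ^{n i}` over `K`. -/
abbrev MPt (K : Type*) [Field K] {ι : Type*} (n : ι → ℕ) :=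
  (i : ι) → Projectivization K (Fin (n i + 1) → K)

/-- Evaluation of a polynomial at (the chosen representatives of) a point of `𝕏`. -/
noncomputable def evalAt (K : Type*) [Field K] {ι : Type*} {n : ι → ℕ} (x : MPt K n)
    (f : MvPolynomial (Σ i : ι, Fin (n i + 1)) K) : K :=
  eval (fun p : Σ i : ι, Fin (n i + 1) => (x p.1).rep p.2) f

/-- Zariski-closed subsets of `𝕏`: common zero loci of families of multihomogeneous
polynomials. -/
def ZariskiClosed (K : Type*) [Field K] {ι : Type*} [DecidableEq ι] {n : ι → ℕ}
    (S : Set (MPt K n)) : Prop :=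
  ∃ 𝔉 : Set (MvPolynomial (Σ i : ι, Fin (n i + 1)) K),
    (∀ f ∈ 𝔉, ∃ d : ι → ℕ,
      f.IsWeightedHomogeneous (fun p : Σ i : ι, Fin (n i + 1) => Pi.single p.1 (1 : ℕ)) d) ∧
    S = {x : MPt K n | ∀ f ∈ 𝔉, evalAt K x f = 0}

/-- A subset of `𝕏` is Zariski dense if the only Zariski-closed subset containing it is
the whole space. -/
def ZariskiDense (K : Type*) [Field K] {ι : Type*} [DecidableEq ι] {n : ι → ℕ}
    (T : Set (MPt K n)) : Prop :=
  ∀ S : Set (MPt K n), ZariskiClosed K S → T ⊆ S → S = Set.univ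

/-- The endomorphism of `𝕏` induced by a tuple of multihomogeneous polynomial components
with no common zero on `𝕏`. -/
noncomputable def inducedMap (K : Type*) [Field K] {ι : Type*} {n : ι → ℕ}
    (F : (i : ι) → Fin (n i + 1) → MvPolynomial (Σ i' : ι, Fin (n i' + 1)) K)
    (hF : ∀ x : (i : ι) → (Fin (n i + 1) → K), (∀ i, x i ≠ 0) → ∀ i,
      ∃ j, eval (fun p : Σ i' : ι, Fin (n i' + 1) => x p.1 p.2) (F i j) ≠ 0) :
    MPt K n → MPt K n :=
  fun x i =>
    Projectivization.mk K (fun j => evalAt K x (F i j)) (by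
      obtain ⟨j, hj⟩ := hF (fun i' => (x i').rep) (fun i' => (x i').rep_nonzero) i
      intro hzero
      exact hj (by simpa [evalAt] using congrFun hzero j))

/-- The height expansion coefficient `μ₁(φ, D) = sup {α | φ*D - α•D is ample}`. -/
noncomputable def heightExpansionCoeff {Pic : Type*} [AddCommGroup Pic] [Module ℝ Pic]
    (IsAmple : Pic → Prop) (φpull : Pic →ₗ[ℝ] Pic) (D : Pic) : ℝ :=
  sSup {α : ℝ | IsAmple (φpull D - α • D)}

/-- The global height expansion coefficient `μ(φ) = sup {μ₁(φ,D) | D ample}`. -/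
noncomputable def globalHeightExpansionCoeff {Pic : Type*} [AddCommGroup Pic] [Module ℝ Pic]
    (IsAmple : Pic → Prop) (φpull : Pic →ₗ[ℝ] Pic) : ℝ :=
  sSup {x : ℝ | ∃ D : Pic, IsAmple D ∧ x = heightExpansionCoeff IsAmple φpull D}

/-- A point `P` is preperiodic for `φ` if its forward orbit `{φⁿ(P) : n ≥ 0}` is finite. -/
def IsPreperiodic {Point : Type*} (φ : Point → Point) (P : Point) : Prop :=
  (Set.range fun N : ℕ => φ^[N] P).Finite

/-- Multiplying by a form of degree `d` shifts homogeneous components by `d`. -/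
theorem MvPolynomial.homogeneousComponent_mul_of_isHomogeneous {σ R : Type*} [CommSemiring R]
    {q : MvPolynomial σ R} {d e : ℕ} (hq : q.IsHomogeneous d) (hde : d ≤ e)
    (p : MvPolynomial σ R) :
    homogeneousComponent e (p * q) = homogeneousComponent (e - d) p * q := by
  classical
  let := gradedAlgebra (R := R) (σ := σ)
  have h := DirectSum.coe_decompose_mul_of_right_mem_of_le (homogeneousSubmodule σ R) (a := p)
    ((mem_homogeneousSubmodule d q).2 hq) hde
  have key (r : MvPolynomial σ R) (i : ℕ) :
      (DirectSum.decompose (homogeneousSubmodule σ R) r i : MvPolynomial σ R) =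
        homogeneousComponent i r := decomposition.decompose'_apply r i
  rwa [key, key] at h

/-- Forms without nontrivial common zero generate an ideal that contains a power of the
irrelevant ideal. -/
theorem MvPolynomial.exists_pow_idealOfVars_le_span {k σ ι : Type*} [Field k] [IsAlgClosed k]
    [Finite σ] (g : ι → MvPolynomial σ k)
    (hzero : ∀ y : σ → k, y ≠ 0 → ∃ j, eval y (g j) ≠ 0) :
    ∃ N, idealOfVars σ k ^ N ≤ Ideal.span (Set.range g) := by
  refine Ideal.exists_pow_le_of_le_radical_of_fg ?_ (idealOfVars_fg σ k)
  rw [← vanishingIdeal_zeroLocus_eq_radical (K := k), zeroLocus_span, idealOfVars, Ideal.span_le]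
  rintro _ ⟨i, rfl⟩ y hy
  by_cases hy0 : y = 0
  · simp [hy0]
  · obtain ⟨j, hj⟩ := hzero y hy0
    exact absurd (by simpa using hy (g j) ⟨j, rfl⟩) hj

/-- A polynomial ring is integral over the subalgebra generated by finitely many forms of the
same positive degree without nontrivial common zero. -/
theorem MvPolynomial.isIntegral_adjoin_range_of_no_common_zero {k σ ι : Type*} [Field k]
    [IsAlgClosed k] [Finite σ] [Finite ι] (g : ι → MvPolynomial σ k) {d : ℕ} (hd : 0 < d)
    (hg : ∀ j, (g j).IsHomogeneous d)
    (hzero : ∀ y : σ → k, y ≠ 0 → ∃ j, eval y (g j) ≠ 0) :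
    Algebra.IsIntegral (Algebra.adjoin k (Set.range g)) (MvPolynomial σ k) := by
  classical
  have := Fintype.ofFinite ι
  obtain ⟨N, hN⟩ := exists_pow_idealOfVars_le_span g hzero
  set A := Algebra.adjoin k (Set.range g)
  set D := max N d
  let B : Set (MvPolynomial σ k) := (fun s ↦ monomial s (1 : k)) '' {s | s.degree < D}
  have hB : B.Finite := (Finsupp.finite_of_degree_lt D).image _
  have hdeg {p : MvPolynomial σ k} {e : ℕ} (hp : p.IsHomogeneous e) {s : σ →₀ ℕ}
      (hs : s ∈ p.support) : s.degree = e :=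
    of_not_not fun h ↦ mem_support_iff.1 hs (hp.coeff_eq_zero h)
  have hom_mem (e : ℕ) : ∀ p : MvPolynomial σ k, p.IsHomogeneous e → p ∈ Submodule.span A B := by
    induction e using Nat.strong_induction_on with
    | _ e ih =>
      intro p hp
      rcases lt_or_ge e D with he | he
      · rw [p.as_sum]
        refine Submodule.sum_mem _ fun s hs ↦ ?_
        have hs' : s.degree < D := (hdeg hp hs).trans_lt he
        have h1 : monomial s (coeff s p) =
            algebraMap k A (coeff s p) • (monomial s (1 : k)) := by
          rw [algebraMap_smul, smul_monomial, smul_eq_mul, mul_one]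
        rw [h1]
        exact Submodule.smul_mem _ _ (Submodule.subset_span ⟨s, hs', rfl⟩)
      · have hpI : p ∈ Ideal.span (Set.range g) := by
          refine hN ((mem_pow_idealOfVars_iff N p).2 fun s hs ↦ ?_)
          exact (le_max_left N d).trans (he.trans (hdeg hp hs).ge)
        obtain ⟨a, ha⟩ := (Ideal.mem_span_range_iff_exists_fun).1 hpI
        have hde : d ≤ e := (le_max_right N d).trans he
        rw [← homogeneousComponent_eq_self hp, ← ha, map_sum]
        refine Submodule.sum_mem _ fun j _ ↦ ?_
        rw [homogeneousComponent_mul_of_isHomogeneous (hg j) hde, mul_comm]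
        exact Submodule.smul_mem _ (⟨g j, Algebra.subset_adjoin ⟨j, rfl⟩⟩ : A)
          (ih (e - d) (by omega) _ (homogeneousComponent_isHomogeneous _ _))
  have : Module.Finite A (MvPolynomial σ k) := by
    refine ⟨⟨hB.toFinset, eq_top_iff.2 fun p _ ↦ ?_⟩⟩
    rw [hB.coe_toFinset, ← p.sum_homogeneousComponent]
    exact Submodule.sum_mem _ fun i _ ↦ hom_mem i _ (homogeneousComponent_isHomogeneous _ _)
  exact Algebra.IsIntegral.of_finite _ _

/-- Finitely many families of forms in separate sets of variables, each consisting of as many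
forms as variables and having no nontrivial common zero, are jointly algebraically independent. -/
theorem MvPolynomial.algebraicIndependent_sigma_of_no_common_zero {k ι : Type*} {σ : ι → Type*}
    [Field k] [IsAlgClosed k] [Finite ι] [∀ i, Finite (σ i)]
    (g : (i : ι) → σ i → MvPolynomial (σ i) k) {d : ι → ℕ} (hd : ∀ i, 0 < d i)
    (hg : ∀ i j, (g i j).IsHomogeneous (d i))
    (hzero : ∀ i, ∀ y : σ i → k, y ≠ 0 → ∃ j, eval y (g i j) ≠ 0) :
    AlgebraicIndependent k (fun p : Σ i, σ i ↦ rename (Sigma.mk p.1) (g p.1 p.2)) := by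
  set G := fun p : Σ i, σ i ↦ rename (Sigma.mk p.1) (g p.1 p.2)
  have halg : Algebra.IsAlgebraic (Algebra.adjoin k (Set.range G))
      (MvPolynomial (Σ i, σ i) k) := by
    refine (IsTranscendenceBasis.mvPolynomial (Σ i, σ i) k).isAlgebraic_iff.2 ?_
    rintro ⟨i, a⟩
    have := isIntegral_adjoin_range_of_no_common_zero (g i) (hd i) (hg i) (hzero i)
    have hle : (Algebra.adjoin k (Set.range (g i))).map (rename (Sigma.mk i)) ≤
        Algebra.adjoin k (Set.range G) := by
      rw [AlgHom.map_adjoin]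
      refine Algebra.adjoin_mono ?_
      rintro _ ⟨_, ⟨j, rfl⟩, rfl⟩
      exact ⟨⟨i, j⟩, rfl⟩
    let φ : Algebra.adjoin k (Set.range (g i)) →+* Algebra.adjoin k (Set.range G) :=
      ((rename (Sigma.mk i) : MvPolynomial (σ i) k →ₐ[k] _).toRingHom.comp
        (Subalgebra.val _).toRingHom).codRestrict _
          fun x ↦ hle ⟨x, x.2, rfl⟩
    obtain ⟨p, hp, hpX⟩ := this.isIntegral (X a)
    refine IsIntegral.isAlgebraic ⟨p.map φ, hp.map φ, ?_⟩
    have h := congrArg (rename (Sigma.mk i) : MvPolynomial (σ i) k →ₐ[k] _) hpX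
    rw [map_zero] at h
    have h2 := Polynomial.hom_eval₂ p (algebraMap (Algebra.adjoin k (Set.range (g i)))
      (MvPolynomial (σ i) k)) (rename (Sigma.mk i) : MvPolynomial (σ i) k →ₐ[k] _).toRingHom (X a)
    rw [Polynomial.eval₂_map]
    refine Eq.trans ?_ (h2.symm.trans h)
    congr 1
    simp
  exact (Algebra.IsAlgebraic.isTranscendenceBasis_of_lift_le_trdeg_of_finite k G
    (by rw [trdeg_of_isDomain]; simp)).1

/-- Scaling the variables block by block scales a multihomogeneous polynomial. -/
theorem MvPolynomial.IsWeightedHomogeneous.eval_mul_of_sigma {k ι : Type*} {σ : ι → Type*}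
    [CommSemiring k] [Fintype ι] [DecidableEq ι] {F : MvPolynomial (Σ i, σ i) k} {e : ι → ℕ}
    (hF : F.IsWeightedHomogeneous (fun p : Σ i, σ i ↦ Pi.single p.1 (1 : ℕ)) e)
    (c : ι → k) (x : (Σ i, σ i) → k) :
    eval (fun p ↦ c p.1 * x p) F = (∏ i, c i ^ e i) * eval x F := by
  rw [eval_eq, eval_eq, Finset.mul_sum]
  refine Finset.sum_congr rfl fun s hs ↦ ?_
  have hw := hF (mem_support_iff.1 hs)
  have hc : ∏ p ∈ s.support, c p.1 ^ s p = ∏ i, c i ^ e i := by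
    rw [← hw]
    simp_rw [Finsupp.weight_apply, Finsupp.sum, Finset.sum_apply, Pi.smul_apply, smul_eq_mul,
      ← Finset.prod_pow_eq_pow_sum]
    rw [Finset.prod_comm]
    refine Finset.prod_congr rfl fun p _ ↦ ?_
    rw [Finset.prod_eq_single p.1 (fun i _ hi ↦ by simp [Pi.single_eq_of_ne hi]) (by simp)]
    simp
  simp_rw [mul_pow, Finset.prod_mul_distrib, hc]
  ring

/-- Scaling all variables scales a form. -/
theorem MvPolynomial.IsHomogeneous.eval_mul_left {k σ : Type*} [CommSemiring k]
    {F : MvPolynomial σ k} {e : ℕ} (hF : F.IsHomogeneous e) (c : k) (x : σ → k) :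
    eval (fun i ↦ c * x i) F = c ^ e * eval x F := by
  rw [eval_eq, eval_eq, Finset.mul_sum]
  refine Finset.sum_congr rfl fun s hs ↦ ?_
  have hw : s.degree = e := of_not_not fun h ↦ mem_support_iff.1 hs (hF.coeff_eq_zero h)
  simp_rw [mul_pow, Finset.prod_mul_distrib, Finset.prod_pow_eq_pow_sum, ← hw, Finsupp.degree_apply]
  ring

/-- A product of endomorphisms of projective spaces of positive degree over an algebraically
closed field is dominant. -/
theorem zariskiDense_range_inducedMap_rename {k : Type*} [Field k] [IsAlgClosed k]
    {ι : Type*} [Fintype ι] [DecidableEq ι] {n : ι → ℕ}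
    (g : (i : ι) → Fin (n i + 1) → MvPolynomial (Fin (n i + 1)) k) {d : ι → ℕ}
    (hd : ∀ i, 0 < d i) (hg : ∀ i j, (g i j).IsHomogeneous (d i))
    (hzero : ∀ i, ∀ y : Fin (n i + 1) → k, y ≠ 0 → ∃ j, eval y (g i j) ≠ 0)
    (hH : ∀ x : (i : ι) → (Fin (n i + 1) → k), (∀ i, x i ≠ 0) → ∀ i,
      ∃ j, eval (fun p : Σ i, Fin (n i + 1) ↦ x p.1 p.2) (rename (Sigma.mk i) (g i j)) ≠ 0) :
    ZariskiDense k (Set.range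
      (inducedMap k (fun i j ↦ rename (Sigma.mk i) (g i j)) hH)) := by
  rintro S ⟨𝔉, h𝔉, rfl⟩ hS
  refine Set.eq_univ_of_forall fun P F hF ↦ ?_
  suffices F = 0 by simp [this, evalAt]
  refine (injective_iff_map_eq_zero _).1
    (algebraicIndependent_sigma_of_no_common_zero g hd hg hzero) F ?_
  refine funext_set (fun _ ↦ {0}ᶜ) (fun _ ↦ (Set.finite_singleton 0).infinite_compl)
    fun y hy ↦ ?_
  have hy0 (i : ι) : (fun a ↦ y ⟨i, a⟩) ≠ 0 := fun h ↦ hy ⟨i, 0⟩ trivial (congrFun h 0)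
  let Q : MPt k n := fun i ↦ Projectivization.mk k (fun a ↦ y ⟨i, a⟩) (hy0 i)
  choose b hb using fun i ↦ Projectivization.exists_smul_eq_mk_rep k _ (hy0 i)
  set T := inducedMap k (fun i j ↦ rename (Sigma.mk i) (g i j)) hH Q
  have hrep (i : ι) : ∃ c : kˣ, ∀ j, (T i).rep j = c * eval (fun a ↦ y ⟨i, a⟩) (g i j) := by
    obtain ⟨c, hc⟩ := Projectivization.exists_smul_eq_mk_rep k
      (fun j ↦ evalAt k Q (rename (Sigma.mk i) (g i j))) (by
        obtain ⟨j, hj⟩ := hH (fun i ↦ (Q i).rep) (fun i ↦ (Q i).rep_nonzero) i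
        exact fun h ↦ hj (congrFun h j))
    refine ⟨c * b i ^ d i, fun j ↦ ?_⟩
    have h1 : (Q i).rep = fun a ↦ (b i : k) * y ⟨i, a⟩ := (hb i).symm
    have h2 : evalAt k Q (rename (Sigma.mk i) (g i j)) =
        (b i : k) ^ d i * eval (fun a ↦ y ⟨i, a⟩) (g i j) := by
      rw [← (hg i j).eval_mul_left, evalAt, eval_rename, ← h1]
      rfl
    refine (congrFun hc j).symm.trans ?_
    simp only [Pi.smul_apply, Units.smul_def, smul_eq_mul, h2]
    push_cast
    ring
  choose c hc using hrep
  obtain ⟨e, he⟩ := h𝔉 F hF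
  have hTF : evalAt k T F = 0 := hS ⟨Q, rfl⟩ F hF
  simp only [evalAt, hc] at hTF
  rw [he.eval_mul_of_sigma (fun i ↦ (c i : k)), mul_eq_zero, Finset.prod_eq_zero_iff] at hTF
  have hF0 := hTF.resolve_left (by simp)
  rw [map_zero, ← hF0, aeval_def, eval_eval₂]
  simp only [eval_rename]
  exact congrArg (fun φ ↦ eval₂ φ _ F) (RingHom.ext fun r ↦ by simp)

/-- For `φ* = diag(d)`, every ample class has height expansion coefficient `min d`. -/
theorem heightExpansionCoeff_diagonal {m : ℕ} (hm : 0 < m) (d : Fin m → ℕ) {D : Fin m → ℝ}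
    (hD : ∀ i, 0 < D i) :
    heightExpansionCoeff (fun b : Fin m → ℝ ↦ ∀ i, 0 < b i)
      (Matrix.toLin' (Matrix.diagonal fun i ↦ (d i : ℝ))) D =
      (Finset.univ.inf' ⟨⟨0, hm⟩, Finset.mem_univ _⟩ d : ℕ) := by
  have h : {α : ℝ | ∀ i, 0 < (Matrix.toLin' (Matrix.diagonal fun i ↦ (d i : ℝ)) D - α • D) i} =
      Set.Iio ((Finset.univ.inf' ⟨⟨0, hm⟩, Finset.mem_univ _⟩ d : ℕ) : ℝ) := by
    obtain ⟨i₀, -, hi₀⟩ := Finset.exists_mem_eq_inf' (s := Finset.univ)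
      ⟨⟨0, hm⟩, Finset.mem_univ _⟩ d
    ext α
    simp only [Matrix.toLin'_apply, Matrix.mulVec_diagonal, Pi.sub_apply, Pi.smul_apply,
      smul_eq_mul, Set.mem_ofPred_eq, Set.mem_Iio, ← sub_mul, mul_pos_iff_of_pos_right (hD _),
      sub_pos]
    refine ⟨fun h ↦ hi₀ ▸ h i₀, fun h i ↦ h.trans_le ?_⟩
    exact_mod_cast Finset.inf'_le d (Finset.mem_univ i)
  rw [heightExpansionCoeff, h, csSup_Iio]

/-- For `φ* = diag(d)`, the global height expansion coefficient is `min d`. -/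
theorem globalHeightExpansionCoeff_diagonal {m : ℕ} (hm : 0 < m) (d : Fin m → ℕ) :
    globalHeightExpansionCoeff (fun b : Fin m → ℝ ↦ ∀ i, 0 < b i)
      (Matrix.toLin' (Matrix.diagonal fun i ↦ (d i : ℝ))) =
      (Finset.univ.inf' ⟨⟨0, hm⟩, Finset.mem_univ _⟩ d : ℕ) := by
  refine (congrArg sSup ?_).trans (csSup_singleton _)
  ext x
  constructor
  · rintro ⟨D, hD, rfl⟩
    exact heightExpansionCoeff_diagonal hm d hD
  · rintro rfl
    exact ⟨fun _ ↦ 1, fun _ ↦ one_pos,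
      (heightExpansionCoeff_diagonal hm d fun _ ↦ one_pos).symm⟩

/-- A function that a self-map expands by a factor larger than `1`, up to a bounded error, is
bounded on preperiodic points. -/
theorem IsPreperiodic.le_of_expanding {Point : Type*} {φ : Point → Point} {h : Point → ℝ}
    {α C : ℝ} (hα : 1 < α) (hφ : ∀ P, α * h P - C ≤ h (φ P)) {P : Point}
    (hP : IsPreperiodic φ P) : h P ≤ C / (α - 1) := by
  obtain ⟨_, ⟨N, rfl⟩, hN⟩ := Set.exists_max_image _ h hP (Set.range_nonempty _)
  refine (hN P ⟨0, rfl⟩).trans ?_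
  have h1 := hN _ ⟨N + 1, rfl⟩
  have h2 := hφ (φ^[N] P)
  rw [← Function.iterate_succ_apply' φ N P] at h2
  rw [le_div_iff₀ (sub_pos.2 hα)]
  linarith

/-- For `i = 1, …, m` let `f_i : ℙⁿ → ℙⁿ` be a morphism of degree
`d_i > 1` defined over a number field `K` (given by degree-`d_i` forms over `K` with no
common nontrivial zero over `K̄`), and let `φ = f_1 × ⋯ × f_m : (ℙⁿ)^m → (ℙⁿ)^m` be the
product morphism.  Then `φ` is a dominant endomorphism with global height expansion
coefficient `μ(φ) = min_i d_i > 1` (computed on `Pic((ℙⁿ)^m) ⊗ ℝ ≅ Fin m → ℝ`, where the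
ample classes are those with positive coordinates and `φ* = diag(d_1, …, d_m)`), and
consequently the set of preperiodic points of `φ` in `(ℙⁿ)^m(K̄)` is a set of bounded
height with respect to any Weil height `h_E` associated to an ample divisor `E`.  Here
`height` is a choice of Weil heights on the `K̄`-points of `(ℙⁿ)^m`, recorded with the
standard properties of the Weil height machine. -/
theorem product_morphism_dominant_and_preperiodic_bounded (K : Type*) [Field K]
    [NumberField K] {n m : ℕ} (hm : 0 < m)
    (d : Fin m → ℕ) (hd : ∀ i, 1 < d i)
    (f : Fin m → (Fin (n + 1) → MvPolynomial (Fin (n + 1)) K))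
    (homog : ∀ i j, (f i j).IsHomogeneous (d i))
    (hf : ∀ i, ∀ y : Fin (n + 1) → AlgebraicClosure K, y ≠ 0 →
      ∃ j, MvPolynomial.eval y
        (MvPolynomial.map (algebraMap K (AlgebraicClosure K)) (f i j)) ≠ 0)
    -- the product data defining `φ = f_1 × ⋯ × f_m` on `(ℙⁿ)^m`
    (hH : ∀ x : (i : Fin m) → (Fin (n + 1) → AlgebraicClosure K), (∀ i, x i ≠ 0) →
      ∀ u, ∃ j, MvPolynomial.eval
        (fun p : Σ _ : Fin m, Fin (n + 1) => x p.1 p.2)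
        (MvPolynomial.rename
          (fun a : Fin (n + 1) => (⟨u, a⟩ : Σ _ : Fin m, Fin (n + 1)))
          (MvPolynomial.map (algebraMap K (AlgebraicClosure K)) (f u j))) ≠ 0)
    -- a choice of Weil height functions on the `K̄`-points of `(ℙⁿ)^m`
    (height : (Fin m → ℝ) → MPt (AlgebraicClosure K) (fun _ : Fin m => n) → ℝ)
    (height_add : ∀ D E : Fin m → ℝ, ∃ C : ℝ, ∀ P,
      |height (D + E) P - (height D P + height E P)| ≤ C)
    (height_smul : ∀ (t : ℝ) (D : Fin m → ℝ), ∃ C : ℝ, ∀ P,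
      |height (t • D) P - t * height D P| ≤ C)
    (height_lower : ∀ D : Fin m → ℝ, (∀ i, 0 < D i) → ∃ C : ℝ, ∀ P, -C ≤ height D P)
    (height_pull : ∀ D : Fin m → ℝ, ∃ C : ℝ, ∀ P,
      |height D (inducedMap (AlgebraicClosure K)
          (fun u j => MvPolynomial.rename
            (fun a : Fin (n + 1) => (⟨u, a⟩ : Σ _ : Fin m, Fin (n + 1)))
            (MvPolynomial.map (algebraMap K (AlgebraicClosure K)) (f u j))) hH P) -
        height (Matrix.toLin' (Matrix.diagonal fun i => (d i : ℝ)) D) P| ≤ C) :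
    -- `φ` is dominant
    ZariskiDense (AlgebraicClosure K) (Set.range (inducedMap (AlgebraicClosure K)
      (fun u j => MvPolynomial.rename
        (fun a : Fin (n + 1) => (⟨u, a⟩ : Σ _ : Fin m, Fin (n + 1)))
        (MvPolynomial.map (algebraMap K (AlgebraicClosure K)) (f u j))) hH)) ∧
    -- `μ(φ) = min_i d_i > 1`
    globalHeightExpansionCoeff (fun b : Fin m → ℝ => ∀ i, 0 < b i)
      (Matrix.toLin' (Matrix.diagonal fun i => (d i : ℝ))) =
      (Finset.univ.inf' ⟨⟨0, hm⟩, Finset.mem_univ _⟩ d : ℕ) ∧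
    1 < globalHeightExpansionCoeff (fun b : Fin m → ℝ => ∀ i, 0 < b i)
      (Matrix.toLin' (Matrix.diagonal fun i => (d i : ℝ))) ∧
    -- the preperiodic points of `φ` form a set of bounded height
    (∀ E : Fin m → ℝ, (∀ i, 0 < E i) → ∃ B : ℝ, ∀ P,
      IsPreperiodic (inducedMap (AlgebraicClosure K)
        (fun u j => MvPolynomial.rename
          (fun a : Fin (n + 1) => (⟨u, a⟩ : Σ _ : Fin m, Fin (n + 1)))
          (MvPolynomial.map (algebraMap K (AlgebraicClosure K)) (f u j))) hH) P →
      height E P ≤ B) := by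
  have hμ := globalHeightExpansionCoeff_diagonal hm d
  refine ⟨zariskiDense_range_inducedMap_rename
    (fun u j ↦ map (algebraMap K (AlgebraicClosure K)) (f u j))
    (fun i ↦ zero_lt_one.trans (hd i)) (fun i j ↦ (homog i j).map _) hf hH, hμ, ?_, ?_⟩
  · rw [hμ]
    exact_mod_cast (Finset.lt_inf'_iff _).2 fun i _ ↦ hd i
  · intro E hE
    set D := Matrix.toLin' (Matrix.diagonal fun i ↦ (d i : ℝ)) E with hD
    obtain ⟨C₁, h₁⟩ := height_pull E
    obtain ⟨C₂, h₂⟩ := height_lower (D - (3 / 2 : ℝ) • E) fun i ↦ by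
      have h2 : (2 : ℝ) ≤ d i := by exact_mod_cast hd i
      simp only [hD, Matrix.toLin'_apply, Matrix.mulVec_diagonal, Pi.sub_apply, Pi.smul_apply,
        smul_eq_mul]
      nlinarith [hE i]
    obtain ⟨C₃, h₃⟩ := height_add (D - (3 / 2 : ℝ) • E) ((3 / 2 : ℝ) • E)
    obtain ⟨C₄, h₄⟩ := height_smul (3 / 2) E
    refine ⟨_, fun P hP ↦ hP.le_of_expanding (α := 3 / 2) (C := C₁ + C₂ + C₃ + C₄) (by norm_num)
      fun Q ↦ ?_⟩
    have k₁ := abs_le.1 (h₁ Q)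
    have k₃ := abs_le.1 (h₃ Q)
    have k₄ := abs_le.1 (h₄ Q)
    rw [sub_add_cancel] at k₃
    linarith [h₂ Q]
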